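/- Let l independent uniformly random spanning converging forests φ_1,...,φ_l be given and let ω̄_ii = (1/l)·Σ_k ω̄_ii(φ_k). For ε, δ ∈ (0,1), if l ≥ (2/(3ε) + 1/(4ε²))·log(2/δ), then with probability at least 1 − δ, (1−ε)ω_ii ≤ ω̄_ii ≤ (1+ε)ω_ii. -/

import Mathlib

open Finset

/-- A spanning converging forest of the digraph with edge relation `E`,
encoded by its successor map `f : V → Option V` (`f i = some j` means edge `(i,j)`
is in the forest, `f i = none` means `i` is a root).  Acyclicity is expressed by a
height function that strictly decreases along edges. -/
def IsSCF {V : Type*} (E : V → V → Prop) (f : V → Option V) : Prop :=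
  (∀ i j, f i = some j → E i j) ∧ ∃ h : V → ℕ, ∀ i j, f i = some j → h j < h i

open scoped Classical in
/-- The set `F` of all spanning converging forests of the digraph `E`. -/
noncomputable def forests {V : Type*} [Fintype V] [DecidableEq V]
    (E : V → V → Prop) : Finset (V → Option V) :=
  Finset.univ.filter (IsSCF E)

/-- The root `r_φ(i)` of the tree containing node `i` in the forest `f`:
follow successors until reaching a root. -/
def rootOf {V : Type*} [Fintype V] (f : V → Option V) (i : V) : V :=
  (fun x => (f x).getD x)^[Fintype.card V] i

/-- The combinatorial forest-matrix entry `ω_{ij} = |F_{ij}| / |F|`. -/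
noncomputable def fOmega {V : Type*} [Fintype V] [DecidableEq V]
    (E : V → V → Prop) (i j : V) : ℝ :=
  (((forests E).filter (fun f => rootOf f i = j)).card : ℝ) / ((forests E).card : ℝ)

/-- Expectation of `g` under a uniformly random spanning converging forest. -/
noncomputable def expVal {V : Type*} [Fintype V] [DecidableEq V]
    (E : V → V → Prop) (g : (V → Option V) → ℝ) : ℝ :=
  (∑ f ∈ forests E, g f) / ((forests E).card : ℝ)

/-- Variance of `g` under a uniformly random spanning converging forest. -/
noncomputable def varVal {V : Type*} [Fintype V] [DecidableEq V]
    (E : V → V → Prop) (g : (V → Option V) → ℝ) : ℝ :=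
  expVal E (fun f => (g f - expVal E g) ^ 2)

/-- The indicator estimator `ω̂_{ij}(φ) = 1_{r_φ(i) = j}`. -/
noncomputable def indEst {V : Type*} [Fintype V] [DecidableEq V]
    (i j : V) (f : V → Option V) : ℝ :=
  if rootOf f i = j then 1 else 0

/-- Out-degree `d_i` of node `i`. -/
def outDeg {V : Type*} [Fintype V] (E : V → V → Prop) [DecidableRel E] (i : V) : ℕ :=
  (Finset.univ.filter (fun j => E i j)).card

/-- In-neighbors `N⁻(j)` of node `j`. -/
def inNbrs {V : Type*} [Fintype V] (E : V → V → Prop) [DecidableRel E] (j : V) : Finset V :=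
  Finset.univ.filter (fun k => E k j)

/-- The out-degree Laplacian `L = D - A`. -/
noncomputable def lap {V : Type*} [Fintype V] [DecidableEq V]
    (E : V → V → Prop) [DecidableRel E] : Matrix V V ℝ :=
  Matrix.of fun i j => (if i = j then (outDeg E i : ℝ) else 0) - (if E i j then (1 : ℝ) else 0)

/-- The forest matrix `Ω = (I + L)⁻¹`. -/
noncomputable def forestMatrix {V : Type*} [Fintype V] [DecidableEq V]
    (E : V → V → Prop) [DecidableRel E] : Matrix V V ℝ :=
  (1 + lap E)⁻¹


lemma exp_le_bern (x c : ℝ) (hc : c < 3) (hx : |x| ≤ c) :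
    Real.exp x ≤ 1 + x + x ^ 2 / (2 * (1 - c / 3)) := by
  have hc0 : 0 ≤ c := (abs_nonneg x).trans hx
  have h1 : HasSum (fun n : ℕ => x ^ n / (n.factorial : ℝ)) (Real.exp x) := by
    rw [Real.exp_eq_exp_ℝ]
    exact NormedSpace.expSeries_div_hasSum_exp x
  have h2 : HasSum (fun n : ℕ => x ^ (n + 2) / ((n + 2).factorial : ℝ)) (Real.exp x - (1 + x)) := by
    have := (hasSum_nat_add_iff' 2).2 h1
    simpa [Finset.sum_range_succ] using this
  have h3 : HasSum (fun n : ℕ => x ^ 2 / 2 * (c / 3) ^ n) (x ^ 2 / 2 * (1 - c / 3)⁻¹) :=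
    (hasSum_geometric_of_lt_one (by positivity) (by linarith)).mul_left _
  have hf : ∀ n : ℕ, (2 * 3 ^ n : ℝ) ≤ ((n + 2).factorial : ℝ) := by
    intro n
    induction n with
    | zero => simp
    | succ n ih =>
      rw [show n + 1 + 2 = (n + 2) + 1 by ring, Nat.factorial_succ]
      push_cast
      have : (3 : ℝ) ≤ (n : ℝ) + 2 + 1 := by
        have : (0 : ℝ) ≤ n := Nat.cast_nonneg n
        linarith
      calc (2 * 3 ^ (n + 1) : ℝ) = 3 * (2 * 3 ^ n) := by ring
        _ ≤ _ := by gcongr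
  have h4 := hasSum_le (fun n => ?_) h2 h3
  · have : x ^ 2 / (2 * (1 - c / 3)) = x ^ 2 / 2 * (1 - c / 3)⁻¹ := by
      rw [div_mul_eq_div_div]; rfl
    linarith
  · calc x ^ (n + 2) / ((n + 2).factorial : ℝ) ≤ |x| ^ (n + 2) / ((n + 2).factorial : ℝ) := by
          apply div_le_div_of_nonneg_right _ (by positivity)
          rw [← abs_pow]; exact le_abs_self _
      _ ≤ |x| ^ (n + 2) / (2 * 3 ^ n) := by
          gcongr
          exact hf n
      _ = x ^ 2 / 2 * (|x| / 3) ^ n := by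
          rw [pow_add, sq_abs, div_pow]; field_simp
      _ ≤ _ := by gcongr

lemma bern_tail {α : Type*} [DecidableEq α] (F : Finset α) (X : α → ℝ)
    (hX : ∀ f ∈ F, |X f| ≤ 1) (h0 : ∑ f ∈ F, X f = 0) (v t : ℝ) (hv : 0 < v) (ht : 0 < t)
    (hvar : ∑ f ∈ F, X f ^ 2 ≤ v * (F.card : ℝ)) (l : ℕ)
    (B : Finset (Fin l → α)) (hB : B ⊆ Fintype.piFinset (fun _ : Fin l => F))
    (hBt : ∀ φ ∈ B, (l : ℝ) * t ≤ ∑ k, X (φ k)) :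
    (B.card : ℝ) ≤ (F.card : ℝ) ^ l * Real.exp (-(l * (t ^ 2 / (2 * (v + t / 3))))) := by
  set a : ℝ := t / (v + t / 3) with ha
  have hD : 0 < v + t / 3 := by positivity
  have ha0 : 0 < a := by positivity
  have ha3 : a < 3 := by
    rw [ha, div_lt_iff₀ hD]; linarith
  have h1a : 1 - a / 3 = v / (v + t / 3) := by
    rw [ha]; field_simp; ring
  -- mgf
  have hm : ∑ f ∈ F, Real.exp (a * X f) ≤ (F.card : ℝ) * Real.exp (a * t / 2) := by
    calc ∑ f ∈ F, Real.exp (a * X f)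
        ≤ ∑ f ∈ F, (1 + a * X f + (a * X f) ^ 2 / (2 * (1 - a / 3))) := by
          apply Finset.sum_le_sum
          intro f hf
          apply exp_le_bern _ _ ha3
          rw [abs_mul, abs_of_pos ha0]
          have := hX f hf
          nlinarith
      _ = (F.card : ℝ) + a * ∑ f ∈ F, X f + a ^ 2 / (2 * (1 - a / 3)) * ∑ f ∈ F, X f ^ 2 := by
          rw [Finset.sum_add_distrib, Finset.sum_add_distrib, Finset.mul_sum, Finset.mul_sum]
          simp only [Finset.sum_const, nsmul_eq_mul, mul_one]
          congr 1
          apply Finset.sum_congr rfl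
          intro f _
          ring
      _ ≤ (F.card : ℝ) + a * 0 + a ^ 2 / (2 * (1 - a / 3)) * (v * (F.card : ℝ)) := by
          rw [h0]
          have : 0 ≤ a ^ 2 / (2 * (1 - a / 3)) := by rw [h1a]; positivity
          gcongr
      _ = (F.card : ℝ) * (a * t / 2 + 1) := by
          rw [h1a, ha]; field_simp; ring
      _ ≤ _ := by
          gcongr
          exact Real.add_one_le_exp _
  have hk : (B.card : ℝ) * Real.exp (a * (l * t)) ≤ ((F.card : ℝ) * Real.exp (a * t / 2)) ^ l := by
    calc (B.card : ℝ) * Real.exp (a * (l * t)) = ∑ φ ∈ B, Real.exp (a * (l * t)) := by simp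
      _ ≤ ∑ φ ∈ B, Real.exp (a * ∑ k, X (φ k)) := by
          apply Finset.sum_le_sum
          intro φ hφ
          have := hBt φ hφ
          gcongr
      _ ≤ ∑ φ ∈ Fintype.piFinset (fun _ : Fin l => F), Real.exp (a * ∑ k, X (φ k)) :=
          Finset.sum_le_sum_of_subset_of_nonneg hB (fun _ _ _ => (Real.exp_pos _).le)
      _ = ∑ φ ∈ Fintype.piFinset (fun _ : Fin l => F), ∏ k, Real.exp (a * X (φ k)) := by
          simp only [Finset.mul_sum, Real.exp_sum]
      _ = (∑ f ∈ F, Real.exp (a * X f)) ^ l := by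
          rw [Finset.sum_prod_piFinset F (fun _ f => Real.exp (a * X f))]; simp
      _ ≤ _ := by
          apply pow_le_pow_left₀ _ hm
          exact Finset.sum_nonneg (fun _ _ => (Real.exp_pos _).le)
  have he : Real.exp (-(l * (t ^ 2 / (2 * (v + t / 3))))) =
      Real.exp (a * t / 2) ^ l * Real.exp (-(a * (l * t))) := by
    rw [← Real.exp_nat_mul, ← Real.exp_add]
    congr 1
    rw [ha]; field_simp; ring
  rw [he, ← mul_assoc, ← mul_pow, Real.exp_neg, ← div_eq_mul_inv, le_div_iff₀ (Real.exp_pos _)]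
  exact hk

/-- Reachability along successor pointers. -/
def Rch {V : Type*} (f : V → Option V) : V → V → Prop :=
  Relation.ReflTransGen (fun x y => f x = some y)

lemma Rch.next {V : Type*} {f : V → Option V} {x y z : V} (h : Rch f x z) (hxz : x ≠ z)
    (hy : f x = some y) : Rch f y z := by
  rcases Relation.ReflTransGen.cases_head h with h | ⟨c, hc, h⟩
  · exact absurd h hxz
  · rw [hy] at hc
    cases hc
    exact h

lemma Rch.of_none {V : Type*} {f : V → Option V} {x z : V} (h : Rch f x z)
    (hx : f x = none) : x = z := by
  rcases Relation.ReflTransGen.cases_head h with h | ⟨c, hc, h⟩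
  · exact h
  · simp [hx] at hc

lemma Rch.cons {V : Type*} {f : V → Option V} {x y z : V} (hy : f x = some y) (h : Rch f y z) :
    Rch f x z := Relation.ReflTransGen.head hy h

lemma Rch.total {V : Type*} {f : V → Option V} {x y z : V} (h1 : Rch f x y) (h2 : Rch f x z) :
    Rch f y z ∨ Rch f z y := by
  apply Relation.ReflTransGen.total_of_right_unique _ h1 h2
  intro a b c hb hc
  simp only [hb, Option.some.injEq] at hc
  exact hc

lemma Rch.height {V : Type*} {f : V → Option V} {h : V → ℕ}
    (hh : ∀ i j, f i = some j → h j < h i) {x y : V} (hr : Rch f x y) : h y ≤ h x := by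
  induction hr with
  | refl => exact le_rfl
  | tail _ hb ih => exact (hh _ _ hb).le.trans ih

lemma rch_iter {V : Type*} (f : V → Option V) (x : V) (n : ℕ) :
    Rch f x ((fun x => (f x).getD x)^[n] x) := by
  induction n with
  | zero => exact Relation.ReflTransGen.refl
  | succ n ih =>
    rw [Function.iterate_succ_apply']
    set y := (fun x => (f x).getD x)^[n] x
    cases hy : f y with
    | none => simpa [hy] using ih
    | some z => simpa [hy] using (show Rch f x z from Relation.ReflTransGen.tail ih hy)

lemma rootOf_none {V : Type*} [Fintype V] {f : V → Option V} {h : V → ℕ}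
    (hh : ∀ i j, f i = some j → h j < h i) (x : V) : f (rootOf f x) = none := by
  by_contra hne
  set T : V → V := fun x => (f x).getD x with hT
  have hstep : ∀ y, f y ≠ none → h (T y) < h y := by
    intro y hy
    obtain ⟨z, hz⟩ := Option.ne_none_iff_exists'.1 hy
    simpa [hT, hz] using hh _ _ hz
  have hfix : ∀ y, f y = none → T y = y := by
    intro y hy; simp [hT, hy]
  have hall : ∀ m, m ≤ Fintype.card V → f (T^[m] x) ≠ none := by
    intro m hm hnone
    apply hne
    obtain ⟨d, hd⟩ := Nat.exists_eq_add_of_le' hm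
    have : rootOf f x = T^[m] x := by
      unfold rootOf
      rw [← hT, hd, Function.iterate_add_apply]
      exact Function.iterate_fixed (hfix _ hnone) d
    rw [this]; exact hnone
  have hdec : ∀ m n, m < n → n ≤ Fintype.card V → h (T^[n] x) < h (T^[m] x) := by
    intro m n hmn hn
    induction n, hmn using Nat.le_induction with
    | base =>
      rw [Nat.succ_eq_add_one, Function.iterate_succ_apply']
      exact hstep _ (hall m (by omega))
    | succ n hmn ih =>
      rw [Function.iterate_succ_apply']
      exact (hstep _ (hall n (by omega))).trans (ih (by omega))
  have hinj : Function.Injective (fun m : Fin (Fintype.card V + 1) => T^[(m : ℕ)] x) := by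
    intro a b hab
    simp only at hab
    rcases lt_trichotomy (a : ℕ) b with hlt | heq | hgt
    · have := hdec _ _ hlt (by omega); rw [hab] at this; omega
    · exact Fin.ext heq
    · have := hdec _ _ hgt (by omega); rw [hab] at this; omega
  have := Fintype.card_le_of_injective _ hinj
  simp at this

lemma rootOf_eq_iff {V : Type*} [Fintype V] {f : V → Option V} {h : V → ℕ}
    (hh : ∀ i j, f i = some j → h j < h i) (x r : V) :
    rootOf f x = r ↔ Rch f x r ∧ f r = none := by
  have h1 : Rch f x (rootOf f x) := rch_iter f x _
  have h2 := rootOf_none hh x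
  constructor
  · rintro rfl; exact ⟨h1, h2⟩
  · rintro ⟨h3, h4⟩
    rcases h1.total h3 with h | h
    · exact h.of_none h2
    · exact (h.of_none h4).symm

lemma mem_forests {V : Type*} [Fintype V] [DecidableEq V] {E : V → V → Prop}
    {f : V → Option V} : f ∈ forests E ↔ IsSCF E f := by
  simp [forests]

/-- Cutting at `i` stays a forest. -/
lemma isSCF_cut {V : Type*} [DecidableEq V] {E : V → V → Prop}
    {f : V → Option V} (hf : IsSCF E f) (i : V) : IsSCF E (Function.update f i none) := by
  obtain ⟨h1, h, h2⟩ := hf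
  have key : ∀ x y, Function.update f i none x = some y → f x = some y := by
    intro x y hxy
    by_cases hx : x = i
    · subst hx; simp at hxy
    · simpa [Function.update_of_ne hx] using hxy
  exact ⟨fun x y hxy => h1 x y (key x y hxy), h, fun x y hxy => h2 x y (key x y hxy)⟩

/-- Adding an edge out of a root `i` to a vertex outside of its tree stays a forest. -/
lemma isSCF_add {V : Type*} [DecidableEq V] {E : V → V → Prop}
    {f : V → Option V} (hf : IsSCF E f) {i j : V} (hi : f i = none) (hij : E i j)
    (hj : ¬ Rch f j i) : IsSCF E (Function.update f i (some j)) := by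
  classical
  obtain ⟨h1, h, h2⟩ := hf
  refine ⟨?_, fun x => if Rch f x i then h x + h j + 1 else h x, ?_⟩
  · intro x y hxy
    by_cases hx : x = i
    · subst hx
      simp only [Function.update_self, Option.some.injEq] at hxy
      exact hxy ▸ hij
    · rw [Function.update_of_ne hx] at hxy
      exact h1 x y hxy
  · intro x y hxy
    by_cases hx : x = i
    · subst hx
      simp only [Function.update_self, Option.some.injEq] at hxy
      subst hxy
      have : Rch f x x := Relation.ReflTransGen.refl
      simp only [this, hj, if_true, if_false]
      omega
    · rw [Function.update_of_ne hx] at hxy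
      have h3 := h2 x y hxy
      have h4 : Rch f x i ↔ Rch f y i := ⟨fun h => h.next hx hxy, fun h => Rch.cons hxy h⟩
      simp only [h4]
      split_ifs <;> omega

/-- Reachability of `k` transfers when the relevant edges are kept. -/
lemma rch_mono {V : Type*} {f g : V → Option V} {k : V}
    (hfg : ∀ x y, x ≠ k → f x = some y → Rch f y k → g x = some y) {x : V}
    (hx : Rch f x k) : Rch g x k := by
  induction hx using Relation.ReflTransGen.head_induction_on with
  | refl => exact Relation.ReflTransGen.refl
  | head h' hr ih =>
    rename_i a c
    by_cases ha : a = k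
    · subst ha; exact Relation.ReflTransGen.refl
    · exact Rch.cons (hfg a c ha h' hr) ih

/-- The counting identity `(1 + d_i) |F_ii| = |F| + |{f : r_f(i) ∈ N⁻(i)}|`. -/
lemma count_identity {V : Type*} [Fintype V] [DecidableEq V]
    (E : V → V → Prop) [DecidableRel E] (hE : ∀ i, ¬ E i i) (i : V) :
    (1 + outDeg E i) * ((forests E).filter (fun f => rootOf f i = i)).card =
      (forests E).card + ((forests E).filter (fun f => rootOf f i ∈ inNbrs E i)).card := by
  classical
  set A := (forests E).filter (fun f => rootOf f i = i) with hA
  set O : Finset (Option V) := Finset.insertNone (Finset.univ.filter (fun j => E i j)) with hO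
  have hAm : ∀ f, f ∈ A ↔ IsSCF E f ∧ f i = none := by
    intro f
    rw [hA, Finset.mem_filter, mem_forests]
    constructor
    · rintro ⟨hf, hr⟩
      obtain ⟨h, hh⟩ := hf.2
      exact ⟨hf, ((rootOf_eq_iff hh _ _).1 hr).2⟩
    · rintro ⟨hf, hr⟩
      obtain ⟨h, hh⟩ := hf.2
      exact ⟨hf, (rootOf_eq_iff hh _ _).2 ⟨Relation.ReflTransGen.refl, hr⟩⟩
  have hOm : ∀ o, o ∈ O ↔ ∀ j, o = some j → E i j := by
    intro o
    rw [hO]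
    cases o <;> simp
  have hS : (A ×ˢ O).card = (1 + outDeg E i) * A.card := by
    rw [Finset.card_product, hO, Finset.card_insertNone, outDeg]; ring
  rw [← hS, ← Finset.card_filter_add_card_filter_not
    (p := fun q : (V → Option V) × Option V => IsSCF E (Function.update q.1 i q.2))]
  congr 1
  · apply Finset.card_nbij' (fun q => Function.update q.1 i q.2)
      (fun g => (Function.update g i none, g i))
    · intro q hq
      simp only [Finset.coe_filter, Set.mem_ofPred_eq] at hq
      exact mem_forests.2 hq.2
    · intro g hg
      have hg' : IsSCF E g := mem_forests.1 hg
      simp only [Finset.coe_filter, Set.mem_ofPred_eq, Finset.mem_product, hAm, hOm]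
      refine ⟨⟨⟨isSCF_cut hg' i, by simp⟩, fun j hj => hg'.1 i j hj⟩, by simpa using hg'⟩
    · rintro ⟨f, o⟩ hq
      simp only [Finset.coe_filter, Set.mem_ofPred_eq, Finset.mem_product, hAm, hOm] at hq
      have := hq.1.1.2
      ext1
      · simp [← this]
      · simp
    · intro g hg
      simp
  · symm
    -- the map `g ↦ (add k → i, cut at i ; old successor of i)` with `k` the root of `i`
    have hGm : ∀ g, g ∈ (forests E).filter (fun f => rootOf f i ∈ inNbrs E i) ↔
        IsSCF E g ∧ E (rootOf g i) i := by
      intro g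
      simp [mem_forests, inNbrs]
    apply Finset.card_bij
      (fun g _ => (Function.update (Function.update g (rootOf g i) (some i)) i none, g i))
    · intro g hg
      rw [hGm] at hg
      obtain ⟨hg, hk⟩ := hg
      obtain ⟨h, hh⟩ := hg.2
      obtain ⟨hik, hkn⟩ := (rootOf_eq_iff hh i _).1 rfl
      set k := rootOf g i
      have hki : k ≠ i := fun hc => hE i (by rwa [hc] at hk)
      simp only [Finset.mem_filter, Finset.mem_product, hAm, hOm]
      refine ⟨⟨⟨?_, by simp⟩, fun j hj => hg.1 i j hj⟩, ?_⟩
      · rw [Function.update_comm hki]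
        apply isSCF_add (isSCF_cut hg i)
        · rw [Function.update_of_ne hki]; exact hkn
        · exact hk
        · intro hc
          have hu : Function.update g i none i = none := by simp
          exact hki (hc.of_none hu).symm
      · simp only [Function.update_idem]
        rintro ⟨-, h', hh'⟩
        set g2 := Function.update (Function.update g k (some i)) i (g i)
        have h5 : Rch g2 i k := by
          apply rch_mono _ hik
          intro x y hx hxy _
          by_cases hxi : x = i
          · subst hxi; simpa [g2] using hxy
          · simpa [g2, hxi, hx] using hxy
        have h6 : g2 k = some i := by simp [g2, hki]
        have h7 := h5.height hh'
        have h8 := hh' _ _ h6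
        omega
    · -- injectivity
      have main : ∀ g, IsSCF E g → E (rootOf g i) i → ∀ f,
          Function.update (Function.update g (rootOf g i) (some i)) i none = f →
          f (rootOf g i) = some i ∧ rootOf g i ≠ i ∧ (∃ j, g i = some j ∧ Rch f j (rootOf g i)) ∧
          g = Function.update (Function.update f i (g i)) (rootOf g i) none := by
        intro g hg hk f hf
        obtain ⟨h, hh⟩ := hg.2
        obtain ⟨hik, hkn⟩ := (rootOf_eq_iff hh i _).1 rfl
        set k := rootOf g i
        have hki : k ≠ i := fun hc => hE i (by rwa [hc] at hk)
        refine ⟨by simp [← hf, hki], hki, ?_, ?_⟩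
        · rcases Relation.ReflTransGen.cases_head hik with h5 | ⟨j, hj, h5⟩
          · exact absurd h5.symm hki
          · refine ⟨j, hj, ?_⟩
            have h6 : ∀ x, Rch g x k → h x ≤ h j → Rch f x k := by
              intro x hx
              induction hx using Relation.ReflTransGen.head_induction_on with
              | refl => intro _; exact Relation.ReflTransGen.refl
              | head h' hr ih =>
                rename_i a c
                intro ha
                have hac := hh _ _ h'
                have hij := hh _ _ hj
                have hai : a ≠ i := by rintro rfl; omega
                have hak : a ≠ k := by rintro rfl; simp [hkn] at h'
                refine Rch.cons ?_ (ih (by omega))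
                rw [← hf]
                simpa [hai, hak] using h'
            exact h6 j h5 le_rfl
        · funext x
          by_cases hxk : x = k
          · subst hxk; simpa using hkn
          · by_cases hxi : x = i
            · subst hxi; simp [hxk]
            · simp [← hf, hxk, hxi]
      intro g1 hg1 g2 hg2 heq
      rw [hGm] at hg1 hg2
      simp only [Prod.mk.injEq] at heq
      obtain ⟨heq, hgi⟩ := heq
      obtain ⟨a1, b1, ⟨j1, c1, d1⟩, e1⟩ := main g1 hg1.1 hg1.2 _ rfl
      obtain ⟨a2, b2, ⟨j2, c2, d2⟩, e2⟩ := main g2 hg2.1 hg2.2 _ heq.symm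
      have hfi : Function.update (Function.update g1 (rootOf g1 i) (some i)) i none i = none := by
        simp
      set f := Function.update (Function.update g1 (rootOf g1 i) (some i)) i none
      have hj : j1 = j2 := by
        rw [c1, c2] at hgi; simpa using hgi
      subst hj
      have hk : rootOf g1 i = rootOf g2 i := by
        by_contra hne
        rcases d1.total d2 with h | h
        · exact b2 ((h.next hne a1).of_none hfi).symm
        · exact b1 ((h.next (Ne.symm hne) a2).of_none hfi).symm
      rw [e1, e2, hk, c1, c2]
    · -- surjectivity
      rintro ⟨f, o⟩ hq
      simp only [Finset.mem_filter, Finset.mem_product, hAm, hOm] at hq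
      obtain ⟨⟨⟨hf, hfi⟩, ho⟩, hn⟩ := hq
      cases o with
      | none => exact absurd (isSCF_cut hf i) hn
      | some j =>
        have hij := ho j rfl
        have hji : Rch f j i := by
          by_contra hc
          exact hn (isSCF_add hf hfi hij hc)
        rcases Relation.ReflTransGen.cases_tail hji with h5 | ⟨k, hjk, hki⟩
        · exact absurd (h5 ▸ hij) (hE i)
        have hjk : Rch f j k := hjk
        have hkine : k ≠ i := by rintro rfl; simp [hfi] at hki
        set g := Function.update (Function.update f i (some j)) k none with hg
        have hgS : IsSCF E g := by
          rw [hg, Function.update_comm hkine.symm]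
          apply isSCF_add (isSCF_cut hf k)
          · simpa [hkine.symm] using hfi
          · exact hij
          · intro hc
            -- j reaches i after cutting k : contradiction with heights
            have hu : Function.update f k none k = none := by simp
            have hjk' : Rch (Function.update f k none) j k := by
              apply rch_mono _ hjk
              intro x y hx hxy _
              simpa [hx] using hxy
            rcases hc.total hjk' with h | h
            · exact hkine (h.of_none (by simpa [hkine.symm] using hfi)).symm
            · exact hkine (h.of_none hu)
        have hgi : g i = some j := by simp [hg, hkine.symm]
        have hroot : rootOf g i = k := by
          obtain ⟨h, hh⟩ := hgS.2
          rw [rootOf_eq_iff hh]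
          refine ⟨Rch.cons hgi (rch_mono ?_ hjk), by simp [hg]⟩
          intro x y hx hxy _
          have hxi : x ≠ i := by rintro rfl; simp [hfi] at hxy
          simpa [hg, hx, hxi] using hxy
        refine ⟨g, (hGm g).2 ⟨hgS, hroot.symm ▸ hf.1 _ _ hki⟩, ?_⟩
        rw [hroot, hgi]
        congr 1
        funext x
        by_cases hxi : x = i
        · subst hxi; simpa using hfi.symm
        · by_cases hxk : x = k
          · subst hxk; simpa [hxi] using hki.symm
          · simp [hg, hxi, hxk]

open scoped Classical in
/-- for l independent uniform spanning converging forests, the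
averaged diagonal estimator ω̄_ii = (1/l)·Σ_k ω̄_ii(φ_k) satisfies, for
ε, δ ∈ (0,1) and l ≥ (2/(3ε) + 1/(4ε²))·log(2/δ), the relative-error guarantee
(1−ε)ω_ii ≤ ω̄_ii ≤ (1+ε)ω_ii with probability at least 1 − δ.  Independent
uniform sampling is modelled by the uniform distribution on tuples of forests. -/
theorem diagEst_concentration {V : Type*} [Fintype V] [DecidableEq V]
    (E : V → V → Prop) [DecidableRel E] (hE : ∀ i, ¬ E i i) (i : V)
    (l : ℕ) (ε δ : ℝ) (hε : 0 < ε ∧ ε < 1) (hδ : 0 < δ ∧ δ < 1)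
    (hl : (2 / (3 * ε) + 1 / (4 * ε ^ 2)) * Real.log (2 / δ) ≤ (l : ℝ)) :
    (1 - δ) *
        ((Finset.univ.filter
            (fun φ : Fin l → (V → Option V) => ∀ k, φ k ∈ forests E)).card : ℝ)
      ≤ ((Finset.univ.filter
            (fun φ : Fin l → (V → Option V) => (∀ k, φ k ∈ forests E) ∧
              (1 - ε) * fOmega E i i ≤
                (1 / (l : ℝ)) * ∑ k, (1 / (1 + (outDeg E i : ℝ))) *
                  (1 + ∑ c ∈ inNbrs E i, indEst i c (φ k)) ∧
              (1 / (l : ℝ)) * ∑ k, (1 / (1 + (outDeg E i : ℝ))) *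
                  (1 + ∑ c ∈ inNbrs E i, indEst i c (φ k)) ≤
                (1 + ε) * fOmega E i i)).card : ℝ) := by
  obtain ⟨hε0, hε1⟩ := hε
  obtain ⟨hδ0, hδ1⟩ := hδ
  set F := forests E with hF
  have hNpos : 0 < F.card := by
    apply Finset.card_pos.2
    refine ⟨fun _ => none, mem_forests.2 ⟨by simp, fun _ => 0, by simp⟩⟩
  have hN : (0 : ℝ) < (F.card : ℝ) := by exact_mod_cast hNpos
  set N : ℝ := (F.card : ℝ) with hNdef
  set D : ℝ := 1 + (outDeg E i : ℝ) with hD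
  have hDpos : 0 < D := by positivity
  set b : (V → Option V) → ℝ := fun f => ∑ c ∈ inNbrs E i, indEst i c f with hb
  have hb' : ∀ f, b f = if rootOf f i ∈ inNbrs E i then 1 else 0 := by
    intro f
    simp [hb, indEst]
  set p : ℝ := ((F.filter (fun f => rootOf f i ∈ inNbrs E i)).card : ℝ) / N with hp
  have hp0 : 0 ≤ p := by positivity
  have hp1 : p ≤ 1 := by
    rw [hp, div_le_one hN, hNdef]
    exact_mod_cast Finset.card_filter_le _ _
  have hsumb : ∑ f ∈ F, b f = p * N := by
    rw [hp, div_mul_cancel₀ _ hN.ne']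
    simp only [hb']
    simp
  have hω : fOmega E i i = (1 + p) / D := by
    have h1 := count_identity E hE i
    have h2 : D * ((F.filter (fun f => rootOf f i = i)).card : ℝ) =
        N + ((F.filter (fun f => rootOf f i ∈ inNbrs E i)).card : ℝ) := by
      rw [hD, hNdef]; exact_mod_cast h1
    rw [eq_div_iff hDpos.ne', hp, fOmega, ← hF, ← hNdef]
    field_simp
    linarith
  have hX0 : ∑ f ∈ F, (b f - p) = 0 := by
    rw [Finset.sum_sub_distrib, hsumb]
    simp only [Finset.sum_const, nsmul_eq_mul, ← hNdef]
    ring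
  have hb01 : ∀ f, b f = 0 ∨ b f = 1 := by
    intro f; rw [hb']; split_ifs <;> simp
  have hX1 : ∀ f ∈ F, |b f - p| ≤ 1 := by
    intro f _
    rw [abs_le]
    rcases hb01 f with h | h <;> rw [h] <;> constructor <;> linarith
  have hX2 : ∑ f ∈ F, (b f - p) ^ 2 ≤ (1 + p) ^ 2 / 8 * N := by
    have h1 : ∀ f, (b f - p) ^ 2 = (1 - 2 * p) * b f + p ^ 2 := by
      intro f
      rcases hb01 f with h | h <;> rw [h] <;> ring
    simp only [h1]
    rw [Finset.sum_add_distrib, ← Finset.mul_sum, hsumb]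
    simp only [Finset.sum_const, nsmul_eq_mul, ← hNdef]
    nlinarith [mul_nonneg hN.le (sq_nonneg (3 * p - 1))]
  have hlog : 0 < Real.log (2 / δ) := by
    apply Real.log_pos
    rw [lt_div_iff₀ hδ0]; linarith
  have hlpos : (0 : ℝ) < (l : ℝ) := lt_of_lt_of_le (by positivity) hl
  set v : ℝ := (1 + p) ^ 2 / 8 with hv
  set t : ℝ := ε * (1 + p) with ht
  have hvpos : 0 < v := by positivity
  have htpos : 0 < t := by positivity
  have hexp : Real.exp (-(l * (t ^ 2 / (2 * (v + t / 3))))) ≤ δ / 2 := by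
    have h1 : 2 * (v + t / 3) / t ^ 2 ≤ 2 / (3 * ε) + 1 / (4 * ε ^ 2) := by
      have : 2 * (v + t / 3) / t ^ 2 = 2 / (3 * ε * (1 + p)) + 1 / (4 * ε ^ 2) := by
        rw [hv, ht]; field_simp; ring
      rw [this]
      have h0 : 2 / (3 * ε * (1 + p)) ≤ 2 / (3 * ε) := by
        apply div_le_div_of_nonneg_left (by norm_num) (by positivity)
        nlinarith [mul_nonneg hε0.le hp0]
      linarith
    have h2 : Real.log (2 / δ) ≤ l * (t ^ 2 / (2 * (v + t / 3))) := by
      have h3 : 2 * (v + t / 3) / t ^ 2 * Real.log (2 / δ) ≤ l :=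
        (mul_le_mul_of_nonneg_right h1 hlog.le).trans hl
      calc Real.log (2 / δ) = (2 * (v + t / 3) / t ^ 2 * Real.log (2 / δ)) *
            (t ^ 2 / (2 * (v + t / 3))) := by field_simp
        _ ≤ _ := by gcongr
    calc Real.exp (-(l * (t ^ 2 / (2 * (v + t / 3))))) ≤ Real.exp (-Real.log (2 / δ)) := by
          gcongr
      _ = δ / 2 := by
          rw [Real.exp_neg, Real.exp_log (by positivity), inv_div]
  set P := Finset.univ.filter (fun φ : Fin l → (V → Option V) => ∀ k, φ k ∈ F) with hP
  have hPpi : P = Fintype.piFinset (fun _ : Fin l => F) := by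
    ext φ; simp [hP]
  have hPcard : (P.card : ℝ) = N ^ l := by
    rw [hPpi]; simp [hNdef]
  set B1 := P.filter (fun φ => (l : ℝ) * t ≤ ∑ k, (b (φ k) - p)) with hB1
  set B2 := P.filter (fun φ => (l : ℝ) * t ≤ ∑ k, (-(b (φ k) - p))) with hB2
  have hc1 : (B1.card : ℝ) ≤ N ^ l * (δ / 2) := by
    refine (bern_tail F (fun f => b f - p) hX1 hX0 v t hvpos htpos hX2 l B1 ?_ ?_).trans ?_
    · rw [← hPpi]; exact Finset.filter_subset _ _
    · intro φ hφ; exact (Finset.mem_filter.1 hφ).2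
    · gcongr
  have hc2 : (B2.card : ℝ) ≤ N ^ l * (δ / 2) := by
    refine (bern_tail F (fun f => -(b f - p)) ?_ ?_ v t hvpos htpos ?_ l B2 ?_ ?_).trans ?_
    · intro f hf; rw [abs_neg]; exact hX1 f hf
    · rw [Finset.sum_neg_distrib, hX0, neg_zero]
    · simp only [neg_sq]; exact hX2
    · rw [← hPpi]; exact Finset.filter_subset _ _
    · intro φ hφ; exact (Finset.mem_filter.1 hφ).2
    · gcongr
  rw [hω]
  set G := Finset.univ.filter
            (fun φ : Fin l → (V → Option V) => (∀ k, φ k ∈ F) ∧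
              (1 - ε) * ((1 + p) / D) ≤
                (1 / (l : ℝ)) * ∑ k, (1 / D) *
                  (1 + ∑ c ∈ inNbrs E i, indEst i c (φ k)) ∧
              (1 / (l : ℝ)) * ∑ k, (1 / D) *
                  (1 + ∑ c ∈ inNbrs E i, indEst i c (φ k)) ≤
                (1 + ε) * ((1 + p) / D)) with hG
  have hsub : P ⊆ G ∪ (B1 ∪ B2) := by
    intro φ hφ
    by_cases h1 : φ ∈ B1
    · simp [h1]
    by_cases h2 : φ ∈ B2
    · simp [h2]
    apply Finset.mem_union_left
    have h1' : ∑ k, (b (φ k) - p) < (l : ℝ) * t := by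
      by_contra hc
      exact h1 (Finset.mem_filter.2 ⟨hφ, not_lt.1 hc⟩)
    have h2' : ∑ k, (-(b (φ k) - p)) < (l : ℝ) * t := by
      by_contra hc
      exact h2 (Finset.mem_filter.2 ⟨hφ, not_lt.1 hc⟩)
    rw [Finset.sum_neg_distrib] at h2'
    have hs : (1 / (l : ℝ)) * ∑ k, (1 / D) * (1 + ∑ c ∈ inNbrs E i, indEst i c (φ k)) =
        ((1 + p) + (1 / (l : ℝ)) * ∑ k, (b (φ k) - p)) / D := by
      have : ∀ k, (1 / D) * (1 + ∑ c ∈ inNbrs E i, indEst i c (φ k)) =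
          (1 / D) * (1 + p + (b (φ k) - p)) := by
        intro k; simp only [hb]; ring
      simp only [this]
      rw [← Finset.mul_sum, Finset.sum_add_distrib]
      simp only [Finset.sum_const, Finset.card_univ, Fintype.card_fin, nsmul_eq_mul]
      field_simp
    set S := ∑ k, (b (φ k) - p)
    have hu : (1 / (l : ℝ)) * S ≤ t := by
      rw [one_div, inv_mul_le_iff₀ hlpos]; linarith
    have hd : -t ≤ (1 / (l : ℝ)) * S := by
      rw [one_div, le_inv_mul_iff₀ hlpos]; linarith
    rw [hG, Finset.mem_filter]
    refine ⟨Finset.mem_univ _, (Finset.mem_filter.1 hφ).2, ?_, ?_⟩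
    · rw [hs, ← mul_div_assoc]
      gcongr
      rw [ht] at hd; linarith
    · rw [hs, ← mul_div_assoc]
      gcongr
      rw [ht] at hu; linarith
  have hcard : (P.card : ℝ) ≤ G.card + (B1.card + B2.card) := by
    have h1 := Finset.card_le_card hsub
    have h2 := Finset.card_union_le G (B1 ∪ B2)
    have h3 := Finset.card_union_le B1 B2
    exact_mod_cast h1.trans (h2.trans (by omega))
  have hfinal : (1 - δ) * (P.card : ℝ) ≤ G.card := by
    rw [hPcard] at hcard ⊢
    linarith
  exact hfinal
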